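/- arXiv:1505.02540 — 6 statements merged into one kernel-verified Lean document; each statement's English description precedes it below -/
import Mathlib

section
/- An uniplicit Markov kernel P on a finite set V satisfies the hypergroup property with respect to x0 ∈ V if and only if x0 ∈ H(P). -/
open scoped BigOperators

/-- A Markov kernel on a finite set `V`: nonnegative entries, row sums equal to 1. -/
def IsMarkov {V : Type*} [Fintype V] (P : Matrix V V ℝ) : Prop :=
  (∀ x y, 0 ≤ P x y) ∧ ∀ x, ∑ y, P x y = 1

/-- Irreducibility: all entries of `∑_{n=1}^{|V|} P^n` are positive. -/
def IsIrreducibleKernel {V : Type*} [Fintype V] [DecidableEq V] (P : Matrix V V ℝ) : Prop :=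
  ∀ x y, 0 < ∑ n ∈ Finset.Icc 1 (Fintype.card V), (P ^ n) x y

/-- A probability measure on `V`, seen as a nonnegative vector of total mass 1. -/
def IsProbVec {V : Type*} [Fintype V] (m : V → ℝ) : Prop :=
  (∀ x, 0 ≤ m x) ∧ ∑ x, m x = 1

/-- A probability measure positive on all points of `V`. -/
def IsPositiveProb {V : Type*} [Fintype V] (μ : V → ℝ) : Prop :=
  (∀ x, 0 < μ x) ∧ ∑ x, μ x = 1

/-- Reversibility of `P` with respect to `μ`. -/
def IsReversible {V : Type*} (P : Matrix V V ℝ) (μ : V → ℝ) : Prop :=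
  ∀ x y, μ x * P x y = μ y * P y x

/-- `P` is uniplicit: reversible with respect to some positive probability, and all its
eigenvalues have multiplicity 1 (every eigenspace has dimension at most one). -/
def Uniplicit {V : Type*} [Fintype V] (P : Matrix V V ℝ) : Prop :=
  (∃ μ : V → ℝ, IsPositiveProb μ ∧ IsReversible P μ) ∧
  ∀ (θ : ℝ) (f g : V → ℝ), P.mulVec f = θ • f → P.mulVec g = θ • g →
    ∃ a b : ℝ, (a ≠ 0 ∨ b ≠ 0) ∧ a • f = b • g

/-- The Markov commutator of `P`: the Markov kernels commuting with `P`. -/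
def MarkovCommutator {V : Type*} [Fintype V] (P : Matrix V V ℝ) : Set (Matrix V V ℝ) :=
  {K | IsMarkov K ∧ K * P = P * K}

/-- `K(P,x)`: the set of rows at `x` of elements of the Markov commutator of `P`. -/
def commRows {V : Type*} [Fintype V] (P : Matrix V V ℝ) (x : V) : Set (V → ℝ) :=
  {m | ∃ K ∈ MarkovCommutator P, m = fun y => K x y}

/-- `H(P) := {x : K(P,x) = P(V)}`. -/
def HSet {V : Type*} [Fintype V] (P : Matrix V V ℝ) : Set V :=
  {x | commRows P x = {m | IsProbVec m}}

/-- The hypergroup property of `P` with respect to `μ` and the point `x0`. -/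
def HypergroupProperty {V : Type*} [Fintype V]
    (P : Matrix V V ℝ) (μ : V → ℝ) (x0 : V) : Prop :=
  ∃ φ : Fin (Fintype.card V) → V → ℝ,
    (∃ k1, ∀ x, φ k1 x = 1) ∧
    (∀ k l, ∑ x, μ x * φ k x * φ l x = if k = l then 1 else 0) ∧
    (∀ k, ∃ θ : ℝ, ∀ x, ∑ y, P x y * φ k y = θ * φ k x) ∧
    (∀ k, φ k x0 ≠ 0) ∧
    ∀ x y z, 0 ≤ ∑ k, φ k x * φ k y * φ k z / φ k x0

/-- `g` is a symmetry of `P`. -/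
def IsSymmetry {V : Type*} (P : Matrix V V ℝ) (g : Equiv.Perm V) : Prop :=
  ∀ x y, P (g x) (g y) = P x y

/-- Orthonormality in `L²(μ)` of a family with `|V|` elements implies completeness. -/
theorem sum_mul_mul_eq_of_orthonormal {V : Type*} [Fintype V] [DecidableEq V] {μ : V → ℝ}
    {φ : Fin (Fintype.card V) → V → ℝ}
    (h : ∀ k l, ∑ x, μ x * φ k x * φ l x = if k = l then 1 else 0) (x y : V) :
    ∑ k, φ k x * (μ y * φ k y) = if x = y then 1 else 0 := by
  have h1 : (Matrix.of fun k x => μ x * φ k x) * (Matrix.of fun x k => φ k x) =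
      (1 : Matrix (Fin (Fintype.card V)) (Fin (Fintype.card V)) ℝ) := by
    ext k l
    simpa [Matrix.mul_apply, Matrix.one_apply] using h k l
  replace h1 := (Matrix.mul_eq_one_comm_of_equiv (Fintype.equivFin V).symm).1 h1
  simpa [Matrix.mul_apply, Matrix.one_apply] using congrFun (congrFun h1 x) y

/-- The spectral theorem for reversible kernels. -/
theorem IsReversible.exists_orthonormal_eigenbasis {V : Type*} [Fintype V] [DecidableEq V]
    {P : Matrix V V ℝ} {μ : V → ℝ} (hμ : ∀ x, 0 < μ x) (hrev : IsReversible P μ) :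
    ∃ (φ : Fin (Fintype.card V) → V → ℝ) (θ : Fin (Fintype.card V) → ℝ),
      (∀ k l, ∑ x, μ x * φ k x * φ l x = if k = l then 1 else 0) ∧
      ∀ k, P.mulVec (φ k) = θ k • φ k := by
  have hs : ∀ x, 0 < √(μ x) := fun x => Real.sqrt_pos.2 (hμ x)
  have hss : ∀ x, √(μ x) * √(μ x) = μ x := fun x => Real.mul_self_sqrt (hμ x).le
  have hS : (Matrix.of fun x y => √(μ x) * P x y / √(μ y)).IsHermitian := by
    ext x y
    have := hrev x y
    have hx := (hs x).ne'
    have hy := (hs y).ne'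
    simp only [Matrix.conjTranspose_apply, Matrix.of_apply, star_trivial]
    rw [div_eq_div_iff hx hy, mul_right_comm, hss, mul_right_comm, hss, this]
  let e := (Fintype.equivFin V).symm
  refine ⟨fun k x => hS.eigenvectorBasis (e k) x / √(μ x), fun k => hS.eigenvalues (e k), ?_, ?_⟩
  · intro k l
    have h := orthonormal_iff_ite.1 hS.eigenvectorBasis.orthonormal (e k) (e l)
    simp only [EmbeddingLike.apply_eq_iff_eq] at h
    rw [← h, PiLp.inner_apply]
    refine Finset.sum_congr rfl fun x _ => ?_
    have hx := (hs x).ne'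
    nth_rewrite 1 [← hss x]
    simp only [RCLike.inner_apply, conj_trivial]
    field_simp
  · intro k
    ext x
    have h := congrFun (hS.mulVec_eigenvectorBasis (e k)) x
    have hx := (hs x).ne'
    simp only [Matrix.mulVec, dotProduct, Matrix.of_apply, Pi.smul_apply, smul_eq_mul] at h ⊢
    rw [← mul_div_assoc, eq_div_iff hx, ← h, Finset.sum_mul]
    refine Finset.sum_congr rfl fun y _ => ?_
    ring

/-- The eigenbasis of a uniplicit Markov kernel may be chosen to contain the constant `1`. -/
theorem Uniplicit.exists_orthonormal_eigenbasis {V : Type*} [Fintype V] [DecidableEq V]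
    [Nonempty V] {P : Matrix V V ℝ} (hP : IsMarkov P) (hU : Uniplicit P) {μ : V → ℝ}
    (hμ : IsPositiveProb μ) (hrev : IsReversible P μ) :
    ∃ (φ : Fin (Fintype.card V) → V → ℝ) (θ : Fin (Fintype.card V) → ℝ),
      (∃ k1, ∀ x, φ k1 x = 1) ∧
      (∀ k l, ∑ x, μ x * φ k x * φ l x = if k = l then 1 else 0) ∧
      ∀ k, P.mulVec (φ k) = θ k • φ k := by
  obtain ⟨φ, θ, ho, he⟩ := hrev.exists_orthonormal_eigenbasis hμ.1
  have hc := sum_mul_mul_eq_of_orthonormal ho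
  obtain ⟨k, hk⟩ : ∃ k, ∑ y, μ y * φ k y ≠ 0 := by
    by_contra! h
    obtain ⟨x⟩ := ‹Nonempty V›
    have h1 : ∑ y, ∑ k, φ k x * (μ y * φ k y) = 1 := by simp [hc]
    rw [Finset.sum_comm] at h1
    simp [← Finset.mul_sum, h] at h1
  have hθ : θ k = 1 := by
    have h1 : ∑ y, μ y * (P.mulVec (φ k)) y = ∑ y, μ y * φ k y := by
      simp only [Matrix.mulVec, dotProduct, Finset.mul_sum]
      rw [Finset.sum_comm]
      refine Finset.sum_congr rfl fun x _ => ?_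
      have : ∀ y, μ y * (P y x * φ k x) = μ x * φ k x * P x y := fun y => by
        rw [← mul_assoc, hrev y x]; ring
      simp only [this, ← Finset.mul_sum, hP.2, mul_one]
    rw [he] at h1
    simp only [Pi.smul_apply, smul_eq_mul, mul_left_comm _ (θ k), ← Finset.mul_sum] at h1
    exact (mul_eq_right₀ hk).1 h1
  have hone : P.mulVec (fun _ => 1) = θ k • (fun _ => (1 : ℝ)) := by
    ext x
    simp [hθ, Matrix.mulVec, dotProduct, hP.2]
  obtain ⟨a, b, hab, h⟩ := hU.2 _ _ _ (he k) hone
  have h' : ∀ x, a * φ k x = b := fun x => by simpa using congrFun h x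
  have ha : a ≠ 0 := by
    rintro rfl
    obtain ⟨x⟩ := ‹Nonempty V›
    have := h' x
    simp_all
  have hφ : ∀ x, φ k x = b / a := fun x => by rw [eq_div_iff ha, mul_comm, h']
  have hsq : b / a * (b / a) = 1 := by
    have := ho k k
    simp only [hφ, if_true, mul_assoc, ← Finset.sum_mul, hμ.2, one_mul] at this
    exact this
  refine ⟨fun l => (b / a) • φ l, θ, ⟨k, fun x => ?_⟩, fun l m => ?_, fun l => ?_⟩
  · simp only [Pi.smul_apply, smul_eq_mul, hφ, hsq]
  · rw [← ho]
    refine Finset.sum_congr rfl fun x _ => ?_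
    simp only [Pi.smul_apply, smul_eq_mul]
    linear_combination (μ x * φ l x * φ m x) * hsq
  · rw [Matrix.mulVec_smul, he, smul_comm]

/-- An eigenvector of a uniplicit kernel is an eigenvector of every commuting matrix. -/
theorem Uniplicit.exists_mulVec_eq_smul {V : Type*} [Fintype V] {P K : Matrix V V ℝ}
    (hU : Uniplicit P) (hK : K * P = P * K) {f : V → ℝ} (hf : f ≠ 0) {θ : ℝ}
    (h : P.mulVec f = θ • f) : ∃ c : ℝ, K.mulVec f = c • f := by
  have h' : P.mulVec (K.mulVec f) = θ • K.mulVec f := by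
    rw [Matrix.mulVec_mulVec, ← hK, ← Matrix.mulVec_mulVec, h, Matrix.mulVec_smul]
  obtain ⟨a, b, hab, e⟩ := hU.2 _ _ _ h h'
  have hb : b ≠ 0 := by
    rintro rfl
    simp_all
  exact ⟨b⁻¹ * a, by rw [mul_smul, e, inv_smul_smul₀ hb]⟩

theorem HypergroupProperty.mem_HSet {V : Type*} [Fintype V] [DecidableEq V]
    {P : Matrix V V ℝ} {μ : V → ℝ} (hμ : IsPositiveProb μ) {x0 : V}
    (h : HypergroupProperty P μ x0) : x0 ∈ HSet P := by
  obtain ⟨φ, ⟨k1, hk1⟩, ho, he, hne, hpos⟩ := h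
  choose θ he using he
  have hc := sum_mul_mul_eq_of_orthonormal ho
  ext m
  constructor
  · rintro ⟨K, ⟨hK, -⟩, rfl⟩
    exact ⟨hK.1 x0, hK.2 x0⟩
  rintro ⟨hm0, hm1⟩
  let F : Matrix V (Fin (Fintype.card V)) ℝ := Matrix.of fun x k => φ k x
  let G : Matrix (Fin (Fintype.card V)) V ℝ := Matrix.of fun k x => μ x * φ k x
  let c : Fin (Fintype.card V) → ℝ := fun k => (∑ x, m x * φ k x) / φ k x0
  have hFG : F * G = 1 := by
    ext x y
    simpa [F, G, Matrix.mul_apply, Matrix.one_apply] using hc x y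
  have hGF : G * F = 1 := by
    ext k l
    simpa [F, G, Matrix.mul_apply, Matrix.one_apply] using ho k l
  have hPF : P * F = F * Matrix.diagonal θ := by
    ext x k
    rw [Matrix.mul_diagonal, Matrix.mul_apply]
    simpa [F, mul_comm] using he k x
  have hP' : P = F * Matrix.diagonal θ * G := by
    rw [← hPF, Matrix.mul_assoc, hFG, Matrix.mul_one]
  have hmul : ∀ A B : Matrix (Fin (Fintype.card V)) (Fin (Fintype.card V)) ℝ,
      F * A * G * (F * B * G) = F * (A * B) * G := fun A B => by
    calc F * A * G * (F * B * G) = F * A * (G * F) * B * G := by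
          simp only [Matrix.mul_assoc]
      _ = F * (A * B) * G := by rw [hGF, Matrix.mul_one]; simp only [Matrix.mul_assoc]
  have hKapp : ∀ y z, (F * Matrix.diagonal c * G) y z = ∑ k, φ k y * c k * (μ z * φ k z) := by
    intro y z
    rw [Matrix.mul_apply]
    simp [Matrix.mul_diagonal, F, G]
  refine ⟨F * Matrix.diagonal c * G, ⟨⟨fun y z => ?_, fun y => ?_⟩, ?_⟩, ?_⟩
  · have : (F * Matrix.diagonal c * G) y z =
        μ z * ∑ x, m x * ∑ k, φ k x * φ k y * φ k z / φ k x0 := by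
      rw [hKapp]
      simp only [c, Finset.mul_sum, Finset.sum_mul, Finset.sum_div]
      rw [Finset.sum_comm]
      refine Finset.sum_congr rfl fun x _ => Finset.sum_congr rfl fun k _ => ?_
      ring
    rw [this]
    exact mul_nonneg (hμ.1 z).le
      (Finset.sum_nonneg fun x _ => mul_nonneg (hm0 x) (hpos x y z))
  · have hsum : ∀ k, ∑ z, μ z * φ k z = if k = k1 then 1 else 0 := fun k => by
      simpa [hk1] using ho k k1
    simp only [hKapp]
    rw [Finset.sum_comm]
    simp [← Finset.mul_sum, hsum, hk1, c, hm1]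
  · rw [hP', hmul, hmul, Matrix.diagonal_mul_diagonal, Matrix.diagonal_mul_diagonal]
    simp only [mul_comm]
  · ext z
    have : ∀ k, φ k x0 * c k = ∑ x, m x * φ k x := fun k => mul_div_cancel₀ _ (hne k)
    simp only [hKapp, this, Finset.sum_mul]
    rw [Finset.sum_comm]
    simp only [mul_assoc, ← Finset.mul_sum, hc]
    simp

theorem Uniplicit.hypergroupProperty_of_mem_HSet {V : Type*} [Fintype V] [DecidableEq V]
    {P : Matrix V V ℝ} (hP : IsMarkov P) (hU : Uniplicit P) {μ : V → ℝ}
    (hμ : IsPositiveProb μ) (hrev : IsReversible P μ) {x0 : V} (h : x0 ∈ HSet P) :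
    HypergroupProperty P μ x0 := by
  have : Nonempty V := ⟨x0⟩
  obtain ⟨φ, θ, h1, ho, he⟩ := hU.exists_orthonormal_eigenbasis hP hμ hrev
  have hc := sum_mul_mul_eq_of_orthonormal ho
  have hφ0 : ∀ k, φ k ≠ 0 := fun k hk => by simpa [hk] using ho k k
  have hK : ∀ x, ∃ K ∈ MarkovCommutator P, (fun y => if x = y then (1 : ℝ) else 0) = K x0 := by
    intro x
    have hx : (fun y => if x = y then (1 : ℝ) else 0) ∈ commRows P x0 := by
      rw [show commRows P x0 = _ from h]
      exact ⟨fun y => by dsimp only; split_ifs <;> norm_num, by simp⟩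
    exact hx
  choose K hK hK0 using hK
  choose c hc' using fun x k => hU.exists_mulVec_eq_smul (hK x).2 (hφ0 k) (he k)
  have hcx : ∀ x k, φ k x = c x k * φ k x0 := fun x k => by
    have := congrFun (hc' x k) x0
    simpa [Matrix.mulVec, ← hK0, dotProduct] using this
  have hne : ∀ k, φ k x0 ≠ 0 := fun k hk => hφ0 k (funext fun x => by simp [hcx x k, hk])
  refine ⟨φ, h1, ho, fun k => ⟨θ k, fun x => ?_⟩, hne, fun x y z => ?_⟩
  · exact congrFun (he k) x
  · have hKz : K x y z = μ z * ∑ k, φ k x * φ k y * φ k z / φ k x0 := by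
      calc K x y z = ∑ w, K x y w * ∑ k, φ k w * (μ z * φ k z) := by simp [hc]
        _ = ∑ k, (K x).mulVec (φ k) y * (μ z * φ k z) := by
          simp only [Matrix.mulVec, dotProduct, Finset.mul_sum, Finset.sum_mul]
          rw [Finset.sum_comm]
          simp only [mul_assoc]
        _ = _ := by
          rw [Finset.mul_sum]
          refine Finset.sum_congr rfl fun k _ => ?_
          rw [hc', Pi.smul_apply, smul_eq_mul, hcx x k]
          have := hne k
          field_simp
    exact nonneg_of_mul_nonneg_right (hKz ▸ (hK x).1.1 y z) (hμ.1 z)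

/-- An uniplicit Markov kernel `P` on a finite set `V` satisfies the
hypergroup property with respect to `x0 ∈ V` if and only if `x0 ∈ H(P)`. -/
theorem uniplicit_hypergroup_iff_mem_HSet
    {V : Type*} [Fintype V] [DecidableEq V]
    (P : Matrix V V ℝ) (hP : IsMarkov P) (hU : Uniplicit P)
    (μ : V → ℝ) (hμ : IsPositiveProb μ) (hrev : IsReversible P μ) (x0 : V) :
    HypergroupProperty P μ x0 ↔ x0 ∈ HSet P :=
  ⟨fun h => h.mem_HSet hμ, fun h => hU.hypergroupProperty_of_mem_HSet hP hμ hrev h⟩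
end

section
/- Let P be an irreducible Markov kernel on a finite set V and let μ be its invariant probability. Then for every x ∈ H(P), μ(x) = min_{y∈V} μ(y). -/
open scoped BigOperators

open Matrix in
/-- Left-invariant vectors of a matrix are left-invariant under all its powers. -/
theorem vecMul_pow_of_vecMul_eq {V R : Type*} [Fintype V] [DecidableEq V] [Semiring R]
    {P : Matrix V V R} {v : V → R} (hv : v ᵥ* P = v) (n : ℕ) : v ᵥ* P ^ n = v := by
  induction n with
  | zero => simp
  | succ n ih => rw [pow_succ, ← Matrix.vecMul_vecMul, ih, hv]

open Matrix in
/-- A nonnegative invariant vector of an irreducible kernel which vanishes somewhere is zero. -/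
theorem IsIrreducibleKernel.eq_zero_of_vecMul_eq {V : Type*} [Fintype V] [DecidableEq V]
    {P : Matrix V V ℝ} (hirr : IsIrreducibleKernel P) {v : V → ℝ} (hv : v ᵥ* P = v)
    (hnonneg : ∀ x, 0 ≤ v x) {z : V} (hz : v z = 0) : v = 0 := by
  have hsum : ∑ x, v x * ∑ n ∈ Finset.Icc 1 (Fintype.card V), (P ^ n) x z = 0 := by
    simp_rw [Finset.mul_sum]
    rw [Finset.sum_comm]
    refine Finset.sum_eq_zero fun n _ => ?_
    exact (congrFun (vecMul_pow_of_vecMul_eq hv n) z).trans hz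
  funext x
  have hx := (Finset.sum_eq_zero_iff_of_nonneg
    fun y _ => mul_nonneg (hnonneg y) (hirr y z).le).1 hsum x (Finset.mem_univ x)
  exact (mul_eq_zero.1 hx).resolve_right (hirr x z).ne'

open Matrix in
/-- An invariant probability of an irreducible kernel is positive. -/
theorem IsIrreducibleKernel.pos_of_vecMul_eq {V : Type*} [Fintype V] [DecidableEq V]
    {P : Matrix V V ℝ} (hirr : IsIrreducibleKernel P) {μ : V → ℝ} (hμ : IsProbVec μ)
    (hinv : μ ᵥ* P = μ) (x : V) : 0 < μ x := by
  refine (hμ.1 x).lt_of_ne fun h => ?_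
  have hsum := hμ.2
  rw [hirr.eq_zero_of_vecMul_eq hinv hμ.1 h.symm] at hsum
  simp at hsum

open Matrix in
/-- The invariant probability of an irreducible kernel is unique. -/
theorem IsIrreducibleKernel.eq_of_vecMul_eq {V : Type*} [Fintype V] [DecidableEq V]
    [Nonempty V] {P : Matrix V V ℝ} (hirr : IsIrreducibleKernel P) {μ ν : V → ℝ}
    (hμ : IsProbVec μ) (hν : IsProbVec ν) (hμP : μ ᵥ* P = μ) (hνP : ν ᵥ* P = ν) : ν = μ := by
  have hpos := hirr.pos_of_vecMul_eq hμ hμP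
  obtain ⟨z, hz⟩ := Finite.exists_min fun x => ν x / μ x
  set c := ν z / μ z with hc
  have hzero : ν - c • μ = 0 := by
    refine hirr.eq_zero_of_vecMul_eq (z := z) ?_ (fun x => ?_) ?_
    · rw [Matrix.sub_vecMul, Matrix.smul_vecMul, hμP, hνP]
    · have h := (le_div_iff₀ (hpos x)).1 (hz x)
      simpa using h
    · simp [hc, div_mul_cancel₀ _ (hpos z).ne']
  have hνc : ν = c • μ := sub_eq_zero.1 hzero
  have hc1 : c = 1 := by
    have hsum := hν.2
    rw [hνc] at hsum
    simpa [← Finset.mul_sum, hμ.2] using hsum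
  rw [hνc, hc1, one_smul]

open Matrix in
/-- Markov kernels map probability vectors to probability vectors. -/
theorem IsProbVec.vecMul {V : Type*} [Fintype V] {K : Matrix V V ℝ} {μ : V → ℝ}
    (hμ : IsProbVec μ) (hK : IsMarkov K) : IsProbVec (μ ᵥ* K) := by
  refine ⟨fun y => Finset.sum_nonneg fun x _ => mul_nonneg (hμ.1 x) (hK.1 x y), ?_⟩
  simp only [Matrix.vecMul, dotProduct]
  rw [Finset.sum_comm]
  simp [← Finset.mul_sum, hK.2, hμ.2]

/-- If `P` is an irreducible Markov kernel on a finite set `V` and `μ` is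
its invariant probability, then `μ(x) = min_{y ∈ V} μ(y)` for every `x ∈ H(P)`. -/
theorem HSet_subset_argmin_of_invariant
    {V : Type*} [Fintype V] [DecidableEq V] [Nonempty V]
    (P : Matrix V V ℝ) (hP : IsMarkov P) (hirr : IsIrreducibleKernel P)
    (μ : V → ℝ) (hμ : IsProbVec μ) (hinv : ∀ y, ∑ x, μ x * P x y = μ y) :
    ∀ x ∈ HSet P, μ x = Finset.univ.inf' Finset.univ_nonempty μ := by
  intro x hx
  refine le_antisymm (Finset.le_inf' _ _ fun y _ => ?_) (Finset.inf'_le _ (Finset.mem_univ x))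
  have hdirac : IsProbVec (Pi.single y 1 : V → ℝ) :=
    ⟨fun z => by by_cases h : z = y <;> simp [h], by simp⟩
  have hx' : commRows P x = {m | IsProbVec m} := hx
  obtain ⟨K, ⟨hK, hcomm⟩, hrow⟩ : (Pi.single y 1 : V → ℝ) ∈ commRows P x := by
    rw [hx']
    exact hdirac
  have hKxy : K x y = 1 := by
    simpa using (congrFun hrow y).symm
  have hμP : Matrix.vecMul μ P = μ := funext hinv
  have hμK : Matrix.vecMul μ K = μ :=
    hirr.eq_of_vecMul_eq hμ (hμ.vecMul hK) hμP (by
      rw [Matrix.vecMul_vecMul, hcomm, ← Matrix.vecMul_vecMul, hμP])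
  calc μ x = μ x * K x y := by rw [hKxy, mul_one]
    _ ≤ ∑ z, μ z * K z y :=
      Finset.single_le_sum (f := fun z => μ z * K z y)
        (fun z _ => mul_nonneg (hμ.1 z) (hK.1 z y)) (Finset.mem_univ x)
    _ = μ y := congrFun hμK y
end

section
/- Let P be an uniplicit Markov kernel on a finite set V and let x0, x1 ∈ H(P). Then there exists g ∈ S_P such that g(x1) = x0. Conversely, every g ∈ S_P maps H(P) into H(P); consequently H(P) is the orbit of any of its elements under S_P. -/
open scoped BigOperators

open Matrix in
/-- A matrix killing every eigenvector of a reversible matrix vanishes. -/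
theorem IsReversible.eq_zero_of_mulVec_eigenvector {V : Type*} [Fintype V] [DecidableEq V]
    {P C : Matrix V V ℝ} {μ : V → ℝ} (hμ : ∀ x, 0 < μ x) (hrev : IsReversible P μ)
    (hC : ∀ (θ : ℝ) (f : V → ℝ), P *ᵥ f = θ • f → C *ᵥ f = 0) : C = 0 := by
  set s : V → ℝ := fun x => √(μ x)
  have hs : ∀ x, s x ≠ 0 := fun x => (Real.sqrt_pos.2 (hμ x)).ne'
  have hss : ∀ x, s x * s x = μ x := fun x => Real.mul_self_sqrt (hμ x).le
  have hS : (Matrix.of fun x y => s x * P x y / s y).IsHermitian := by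
    ext x y
    have h := hrev x y
    rw [← hss, ← hss] at h
    have hx := hs x
    have hy := hs y
    simp only [Matrix.conjTranspose_apply, Matrix.of_apply, star_trivial]
    field_simp
    linarith
  have hker : ∀ i, C *ᵥ (fun y => hS.eigenvectorBasis i y / s y) = 0 := by
    intro i
    refine hC (hS.eigenvalues i) _ ?_
    ext x
    have h := congrFun (hS.mulVec_eigenvectorBasis i) x
    simp only [Matrix.mulVec, dotProduct, Matrix.of_apply, Pi.smul_apply, smul_eq_mul] at h ⊢
    rw [← mul_div_assoc, ← h, eq_div_iff (hs x), Finset.sum_mul]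
    refine Finset.sum_congr rfl fun y _ => ?_
    ring
  let L : EuclideanSpace ℝ V →ₗ[ℝ] (V → ℝ) :=
    (Matrix.of fun x y => C x y / s y).mulVecLin ∘ₗ (WithLp.linearEquiv 2 ℝ (V → ℝ)).toLinearMap
  have hL : L = 0 := by
    refine hS.eigenvectorBasis.toBasis.ext fun i => ?_
    rw [OrthonormalBasis.coe_toBasis, LinearMap.zero_apply, ← hker i]
    ext x
    simp only [L, LinearMap.comp_apply, Matrix.mulVecLin_apply, Matrix.mulVec, dotProduct,
      Matrix.of_apply]
    refine Finset.sum_congr rfl fun y _ => ?_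
    exact div_mul_eq_mul_div₀ _ _ _ |>.trans (mul_div_assoc _ _ _)
  ext x y
  have h := congrFun (LinearMap.congr_fun hL (WithLp.toLp 2 (Pi.single y 1))) x
  simpa [L, hs] using h

open Matrix in
/-- The commutant of a uniplicit matrix is commutative. -/
theorem Uniplicit.commute_of_commute {V : Type*} [Fintype V]
    {P A B : Matrix V V ℝ} (hU : Uniplicit P) (hA : A * P = P * A) (hB : B * P = P * B) :
    A * B = B * A := by
  classical
  obtain ⟨⟨μ, ⟨hμ, -⟩, hrev⟩, hmult⟩ := hU
  have key : ∀ D : Matrix V V ℝ, D * P = P * D → ∀ (θ : ℝ) (f : V → ℝ), f ≠ 0 → P *ᵥ f = θ • f →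
      ∃ c : ℝ, D *ᵥ f = c • f := by
    intro D hD θ f hf hPf
    have hDf : P *ᵥ (D *ᵥ f) = θ • (D *ᵥ f) := by
      rw [mulVec_mulVec, ← hD, ← mulVec_mulVec, hPf, mulVec_smul]
    obtain ⟨a, b, hab, h⟩ := hmult θ (D *ᵥ f) f hDf hPf
    have ha : a ≠ 0 := by
      rintro rfl
      rw [zero_smul, eq_comm, smul_eq_zero] at h
      simp_all
    exact ⟨a⁻¹ * b, by rw [mul_smul, ← h, smul_smul, inv_mul_cancel₀ ha, one_smul]⟩
  refine sub_eq_zero.1 (hrev.eq_zero_of_mulVec_eigenvector hμ fun θ f hPf => ?_)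
  rcases eq_or_ne f 0 with rfl | hf
  · exact mulVec_zero _
  obtain ⟨a, ha⟩ := key A hA θ f hf hPf
  obtain ⟨b, hb⟩ := key B hB θ f hf hPf
  rw [sub_mulVec, ← mulVec_mulVec, ← mulVec_mulVec, ha, hb, mulVec_smul, mulVec_smul, ha, hb,
    smul_comm, sub_self]

theorem isProbVec_single {V : Type*} [Fintype V] [DecidableEq V] (y : V) :
    IsProbVec (Pi.single y 1 : V → ℝ) :=
  ⟨fun x => by rw [Pi.single_apply]; split_ifs <;> norm_num, by simp⟩

theorem exists_markovCommutator_row_eq_single {V : Type*} [Fintype V] [DecidableEq V]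
    {P : Matrix V V ℝ} {x : V} (hx : x ∈ HSet P) (y : V) :
    ∃ K ∈ MarkovCommutator P, K x = Pi.single y 1 := by
  have h : (Pi.single y 1 : V → ℝ) ∈ commRows P x := by
    rw [show commRows P x = _ from hx]
    exact isProbVec_single y
  obtain ⟨K, hK, h⟩ := h
  exact ⟨K, hK, h.symm⟩

/-- An element of the commutant of a uniplicit matrix is determined by its row at a point
of `HSet P`. -/
theorem Uniplicit.eq_one_of_row_eq_single {V : Type*} [Fintype V] [DecidableEq V]
    {P N : Matrix V V ℝ} (hU : Uniplicit P) {x : V} (hx : x ∈ HSet P) (hN : N * P = P * N)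
    (hrow : N x = Pi.single x 1) : N = 1 := by
  ext y z
  obtain ⟨A, ⟨-, hA⟩, hAx⟩ := exists_markovCommutator_row_eq_single hx y
  have h := congrFun (congrFun (hU.commute_of_commute hA hN) x) z
  simpa [Matrix.mul_apply, hAx, hrow, Pi.single_apply, Matrix.one_apply, eq_comm] using h

theorem IsMarkov.exists_pos {V : Type*} [Fintype V] {K : Matrix V V ℝ} (hK : IsMarkov K)
    (x : V) : ∃ y, 0 < K x y := by
  by_contra! h
  have := Finset.sum_nonpos fun y (_ : y ∈ Finset.univ) => h y
  linarith [hK.2 x]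

theorem IsMarkov.apply_eq_one {V : Type*} [Fintype V] {K : Matrix V V ℝ} (hK : IsMarkov K)
    {x y : V} (h : ∀ z, z ≠ y → K x z = 0) : K x y = 1 := by
  rw [← hK.2 x, Finset.sum_eq_single y (fun z _ hz => h z hz) (by simp)]

theorem apply_eq_zero_of_mul_eq_one {V : Type*} [Fintype V] [DecidableEq V]
    {K L : Matrix V V ℝ} (hK : IsMarkov K) (hL : IsMarkov L) (hKL : K * L = 1) {x y z : V}
    (hxy : 0 < K x y) (hz : z ≠ x) : L y z = 0 := by
  have h := congrFun (congrFun hKL x) z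
  rw [Matrix.mul_apply, Matrix.one_apply_ne hz.symm,
    Finset.sum_eq_zero_iff_of_nonneg fun w _ => mul_nonneg (hK.1 x w) (hL.1 w z)] at h
  exact (mul_eq_zero.1 (h y (Finset.mem_univ y))).resolve_left hxy.ne'

/-- A Markov kernel with a Markov inverse is a permutation matrix. -/
theorem IsMarkov.exists_perm_of_mul_eq_one {V : Type*} [Fintype V] [DecidableEq V]
    {K L : Matrix V V ℝ} (hK : IsMarkov K) (hL : IsMarkov L) (hKL : K * L = 1) :
    ∃ g : Equiv.Perm V, ∀ x, K x = Pi.single (g x) 1 := by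
  have hLK : L * K = 1 := mul_eq_one_comm.1 hKL
  choose g hg using hK.exists_pos
  have hLg : ∀ x, L (g x) x = 1 := fun x =>
    hL.apply_eq_one fun z hz => apply_eq_zero_of_mul_eq_one hK hL hKL (hg x) hz
  have hK0 : ∀ x z, z ≠ g x → K x z = 0 := fun x z hz =>
    apply_eq_zero_of_mul_eq_one hL hK hLK (by rw [hLg]; exact one_pos) hz
  have hinj : Function.Injective g := by
    intro x x' h
    by_contra hne
    have h0 := apply_eq_zero_of_mul_eq_one hK hL hKL (hg x) (Ne.symm hne)
    rw [h, hLg] at h0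
    exact one_ne_zero h0
  refine ⟨Equiv.ofBijective g (Finite.injective_iff_bijective.1 hinj), fun x => ?_⟩
  ext z
  by_cases hz : z = g x
  · subst hz
    simpa using hK.apply_eq_one (hK0 x)
  · simpa [Pi.single_apply, hz] using hK0 x z hz

theorem isSymmetry_of_commute {V : Type*} [Fintype V] [DecidableEq V]
    {P K : Matrix V V ℝ} {g : Equiv.Perm V} (hg : ∀ x, K x = Pi.single (g x) 1)
    (hK : K * P = P * K) : IsSymmetry P g := by
  intro x y
  have h := congrFun (congrFun hK x) (g y)
  simpa [Matrix.mul_apply, hg, Pi.single_apply] using h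

theorem exists_isSymmetry_of_mem_HSet {V : Type*} [Fintype V] [DecidableEq V]
    {P : Matrix V V ℝ} (hU : Uniplicit P) {x y : V} (hx : x ∈ HSet P) (hy : y ∈ HSet P) :
    ∃ g : Equiv.Perm V, IsSymmetry P g ∧ g x = y := by
  obtain ⟨K, ⟨hK, hKP⟩, hKx⟩ := exists_markovCommutator_row_eq_single hx y
  obtain ⟨L, ⟨hL, hLP⟩, hLy⟩ := exists_markovCommutator_row_eq_single hy x
  have hKL : K * L = 1 := by
    refine hU.eq_one_of_row_eq_single hx ?_ ?_
    · rw [mul_assoc, hLP, ← mul_assoc, hKP, mul_assoc]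
    · ext z
      simp [Matrix.mul_apply, hKx, hLy, Pi.single_apply]
  obtain ⟨g, hg⟩ := hK.exists_perm_of_mul_eq_one hL hKL
  refine ⟨g, isSymmetry_of_commute hg hKP, ?_⟩
  by_contra hne
  have h := congrFun (hKx.symm.trans (hg x)) y
  simp [Ne.symm hne] at h

theorem IsSymmetry.map_mem_HSet {V : Type*} [Fintype V] {P : Matrix V V ℝ}
    {g : Equiv.Perm V} (hg : IsSymmetry P g) {x : V} (hx : x ∈ HSet P) : g x ∈ HSet P := by
  refine Set.Subset.antisymm ?_ fun m hm => ?_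
  · rintro _ ⟨K, ⟨hK, -⟩, rfl⟩
    exact ⟨hK.1 _, hK.2 _⟩
  · have hmg : m ∘ g ∈ commRows P x := by
      rw [show commRows P x = _ from hx]
      exact ⟨fun y => hm.1 _, (Equiv.sum_comp g m).trans hm.2⟩
    obtain ⟨K, ⟨hK, hKP⟩, hKx⟩ := hmg
    have hPg : P.submatrix g.symm g.symm = P := by
      ext y z
      simpa using (hg (g.symm y) (g.symm z)).symm
    refine ⟨K.submatrix g.symm g.symm,
      ⟨⟨fun _ _ => hK.1 _ _, fun y => ?_⟩, ?_⟩, ?_⟩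
    · exact (Equiv.sum_comp g.symm (K (g.symm y))).trans (hK.2 _)
    · have h := congrArg (fun M : Matrix V V ℝ => M.submatrix g.symm g.symm) hKP
      simpa only [← Matrix.submatrix_mul_equiv _ _ _ g.symm, hPg] using h
    · ext y
      simpa using congrFun hKx (g.symm y)

/-- For an uniplicit Markov kernel `P`: any two points of `H(P)` are
related by a symmetry of `P`; conversely every symmetry of `P` stabilizes `H(P)`;
consequently `H(P)` is the orbit of any of its elements under the symmetry group. -/
theorem HSet_orbit_of_symmetry_group
    {V : Type*} [Fintype V] [DecidableEq V]
    (P : Matrix V V ℝ) (hP : IsMarkov P) (hU : Uniplicit P) :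
    (∀ x0 ∈ HSet P, ∀ x1 ∈ HSet P,
        ∃ g : Equiv.Perm V, IsSymmetry P g ∧ g x1 = x0) ∧
    (∀ g : Equiv.Perm V, IsSymmetry P g → ∀ x ∈ HSet P, g x ∈ HSet P) ∧
    (∀ x ∈ HSet P, HSet P = {y | ∃ g : Equiv.Perm V, IsSymmetry P g ∧ g x = y}) := by
  have hsymm : ∀ g : Equiv.Perm V, IsSymmetry P g → ∀ x ∈ HSet P, g x ∈ HSet P :=
    fun g hg x hx => hg.map_mem_HSet hx
  refine ⟨fun x0 h0 x1 h1 => exists_isSymmetry_of_mem_HSet hU h1 h0, hsymm, fun x hx => ?_⟩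
  refine Set.Subset.antisymm (fun y hy => exists_isSymmetry_of_mem_HSet hU hx hy) ?_
  rintro _ ⟨g, hg, rfl⟩
  exact hsymm g hg x hx
end

section
/- Let P be an uniplicit Markov kernel on a finite set V. Then K(P) = A(P) ∩ K(V), where A(P) is the algebra of real polynomials in P and K(V) is the set of Markov kernels on V; i.e. a Markov kernel K commutes with P if and only if K = a_0 I + a_1 P + ... + a_n P^n for some n ∈ ℤ_+ and real coefficients a_0,...,a_n. Moreover, if Λ is a Markov kernel from a finite set V̄ to V such that ΛΛ*Λ = Λ, and P̄ is an uniplicit Markov kernel on V̄, reversible with respect to a positive probability μ̄ with μ := μ̄Λ positive, satisfying ΛΛ*P̄Λ = P̄Λ, then ΛΛ*K̄Λ = K̄Λ for every K̄ ∈ K(P̄). -/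
open scoped BigOperators

/-- A Markov kernel from a finite set `V̄` to a finite set `V`. -/
def IsMarkovRect {Vb V : Type*} [Fintype V] (Λ : Matrix Vb V ℝ) : Prop :=
  (∀ xb y, 0 ≤ Λ xb y) ∧ ∀ xb, ∑ y, Λ xb y = 1

/-- The dual kernel `Λ*` of `Λ`, with respect to `μ̄` on `V̄` and `μ = μ̄Λ` on `V`:
`Λ*(x,x̄) = μ̄(x̄)Λ(x̄,x)/μ(x)`. -/
noncomputable def dualKernel {Vb V : Type*} (μb : Vb → ℝ) (μ : V → ℝ)
    (Λ : Matrix Vb V ℝ) : Matrix V Vb ℝ :=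
  Matrix.of fun x xb => μb xb * Λ xb x / μ x

open Matrix in
/-- A matrix reversible with respect to a positive vector has a basis of eigenvectors. -/
theorem IsReversible.exists_eigenbasis {V : Type*} [Fintype V] [DecidableEq V]
    {P : Matrix V V ℝ} {μ : V → ℝ} (hμ : ∀ x, 0 < μ x) (hP : IsReversible P μ) :
    ∃ (b : Module.Basis V ℝ (V → ℝ)) (θ : V → ℝ), ∀ i, P *ᵥ b i = θ i • b i := by
  have hs : ∀ x, √(μ x) ≠ 0 := fun x => (Real.sqrt_pos.2 (hμ x)).ne'
  have hsq : ∀ x, √(μ x) * √(μ x) = μ x := fun x => Real.mul_self_sqrt (hμ x).le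
  let S : Matrix V V ℝ := Matrix.of fun x y => √(μ x) * P x y / √(μ y)
  have hS : S.IsHermitian := by
    ext x y
    simp only [S, conjTranspose_apply, of_apply, star_trivial]
    rw [div_eq_div_iff (hs x) (hs y)]
    linear_combination (P y x) * hsq y - (P x y) * hsq x - hP x y
  let e : (V → ℝ) ≃ₗ[ℝ] (V → ℝ) :=
    LinearEquiv.piCongrRight fun x => LinearEquiv.smulOfNeZero ℝ ℝ (√(μ x))⁻¹ (inv_ne_zero (hs x))
  let b := (hS.eigenvectorBasis.toBasis.map (WithLp.linearEquiv 2 ℝ (V → ℝ))).map e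
  have hb : ∀ i x, b i x = (√(μ x))⁻¹ * hS.eigenvectorBasis i x := fun i x => by
    simp [b, e]
  refine ⟨b, hS.eigenvalues, fun i => ?_⟩
  ext x
  have h := congrFun (hS.mulVec_eigenvectorBasis i) x
  simp only [mulVec, dotProduct, S, of_apply, Pi.smul_apply, smul_eq_mul] at h
  simp only [mulVec, dotProduct, Pi.smul_apply, smul_eq_mul, hb]
  rw [mul_left_comm, ← h, Finset.mul_sum]
  refine Finset.sum_congr rfl fun y _ => ?_
  have := hs x
  have := hs y
  field_simp

open Matrix in
theorem Matrix.aeval_mulVec_of_eigenvector {V R : Type*} [Fintype V] [DecidableEq V] [CommRing R]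
    {P : Matrix V V R} {θ : R} {v : V → R} (h : P *ᵥ v = θ • v) (q : Polynomial R) :
    Polynomial.aeval P q *ᵥ v = q.eval θ • v := by
  induction q using Polynomial.induction_on' with
  | add p q hp hq => simp [add_mulVec, add_smul, hp, hq]
  | monomial n a =>
    have hn : P ^ n *ᵥ v = θ ^ n • v := by
      induction n with
      | zero => simp
      | succ n ih => rw [pow_succ, ← mulVec_mulVec, h, mulVec_smul, ih, smul_smul, pow_succ']
    simp [Polynomial.aeval_monomial, Polynomial.eval_monomial, Algebra.algebraMap_eq_smul_one,
      smul_mulVec, hn, smul_smul]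

open Matrix in
/-- Every matrix commuting with a uniplicit matrix is a polynomial in it. -/
theorem Uniplicit.exists_eq_aeval {V : Type*} [Fintype V] [DecidableEq V]
    {P : Matrix V V ℝ} (hU : Uniplicit P) {K : Matrix V V ℝ} (hK : K * P = P * K) :
    ∃ q : Polynomial ℝ, K = Polynomial.aeval P q := by
  obtain ⟨⟨μ, hμ, hrev⟩, huni⟩ := hU
  obtain ⟨b, θ, hb⟩ := hrev.exists_eigenbasis hμ.1
  have hθ : Function.Injective θ := by
    intro i j hij
    by_contra hne
    obtain ⟨s, t, hst, h⟩ := huni (θ i) (b i) (b j) (hb i) (hij ▸ hb j)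
    have hs := congrArg (b.repr · i) h
    have ht := congrArg (b.repr · j) h
    simp [hne, Ne.symm hne] at hs ht
    simp_all
  have hκ : ∀ i, ∃ κ : ℝ, K *ᵥ b i = κ • b i := by
    intro i
    obtain ⟨s, t, hst, h⟩ := huni (θ i) (b i) (K *ᵥ b i) (hb i) (by
      rw [mulVec_mulVec, ← hK, ← mulVec_mulVec, hb, mulVec_smul])
    have ht : t ≠ 0 := by
      rintro rfl
      rw [zero_smul, smul_eq_zero] at h
      exact hst.elim (fun hs => h.elim hs (b.ne_zero i)) (fun h0 => h0 rfl)
    exact ⟨t⁻¹ * s, by rw [mul_smul, h, smul_smul, inv_mul_cancel₀ ht, one_smul]⟩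
  choose κ hκ using hκ
  refine ⟨Lagrange.interpolate Finset.univ θ κ, Matrix.toLin'.injective (b.ext fun i => ?_)⟩
  rw [toLin'_apply, toLin'_apply, aeval_mulVec_of_eigenvector (hb i), hκ,
    Lagrange.eval_interpolate_at_node κ hθ.injOn (Finset.mem_univ i)]

/-- If the projection `Λ * L` fixes the columns of `Λ` and of `P * Λ`, then it fixes those of
`p(P) * Λ` for every polynomial `p`. -/
theorem Matrix.mul_aeval_mul_of_mul_mul {m n R : Type*} [Fintype m] [DecidableEq m] [Fintype n]
    [CommRing R] {Λ : Matrix m n R} {L : Matrix n m R} {P : Matrix m m R}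
    (hΛ : Λ * L * Λ = Λ) (hP : Λ * L * P * Λ = P * Λ) (q : Polynomial R) :
    Λ * L * Polynomial.aeval P q * Λ = Polynomial.aeval P q * Λ := by
  induction q using Polynomial.induction_on' with
  | add p q hp hq => simp only [map_add, Matrix.mul_add, Matrix.add_mul, hp, hq]
  | monomial n a =>
    have hn : Λ * L * P ^ n * Λ = P ^ n * Λ := by
      induction n with
      | zero => simpa using hΛ
      | succ n ih =>
        calc Λ * L * P ^ (n + 1) * Λ = Λ * L * P * (P ^ n * Λ) := by
              rw [pow_succ']; simp only [Matrix.mul_assoc]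
          _ = (Λ * L * P * Λ) * (L * P ^ n * Λ) := by
              rw [← ih]; simp only [Matrix.mul_assoc]
          _ = P * (Λ * L * P ^ n * Λ) := by rw [hP]; simp only [Matrix.mul_assoc]
          _ = P ^ (n + 1) * Λ := by rw [ih, pow_succ', Matrix.mul_assoc]
    rw [Polynomial.aeval_monomial, Algebra.algebraMap_eq_smul_one, smul_mul_assoc, one_mul,
      Matrix.mul_smul, Matrix.smul_mul, Matrix.smul_mul, hn]

/-- For an uniplicit Markov kernel `P`, the Markov commutator `K(P)`
coincides with the Markov kernels which are polynomials in `P`. Moreover, if `Λ` is a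
Markov kernel from `V̄` to `V` with `ΛΛ*Λ = Λ`, and `P̄` is an uniplicit Markov kernel
on `V̄` reversible with respect to a positive `μ̄` with `μ := μ̄Λ` positive and
`ΛΛ*P̄Λ = P̄Λ`, then `ΛΛ*K̄Λ = K̄Λ` for every `K̄ ∈ K(P̄)`. -/
theorem commutator_eq_polynomials_and_link_property
    {V : Type*} [Fintype V] [DecidableEq V]
    (P : Matrix V V ℝ) (hP : IsMarkov P) (hU : Uniplicit P) :
    (MarkovCommutator P =
      {K | IsMarkov K ∧ ∃ q : Polynomial ℝ, K = Polynomial.aeval P q}) ∧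
    (∀ (Vb : Type) [Fintype Vb] [DecidableEq Vb]
        (Λ : Matrix Vb V ℝ) (μb : Vb → ℝ) (Pb : Matrix Vb Vb ℝ),
      IsMarkovRect Λ → IsPositiveProb μb → IsMarkov Pb → IsReversible Pb μb →
      Uniplicit Pb →
      (∀ x, 0 < Matrix.vecMul μb Λ x) →
      Λ * dualKernel μb (Matrix.vecMul μb Λ) Λ * Λ = Λ →
      Λ * dualKernel μb (Matrix.vecMul μb Λ) Λ * Pb * Λ = Pb * Λ →
      ∀ Kb ∈ MarkovCommutator Pb,
        Λ * dualKernel μb (Matrix.vecMul μb Λ) Λ * Kb * Λ = Kb * Λ) := by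
  refine ⟨?_, ?_⟩
  · ext K
    refine and_congr_right fun _ => ⟨hU.exists_eq_aeval, ?_⟩
    rintro ⟨q, rfl⟩
    simpa using congrArg (Polynomial.aeval P) (mul_comm q Polynomial.X)
  · intro Vb _ _ Λ μb Pb _ _ _ _ hUb _ hΛ hPΛ Kb hKb
    obtain ⟨q, rfl⟩ := hUb.exists_eq_aeval hKb.2
    exact Matrix.mul_aeval_mul_of_mul_mul hΛ hPΛ q
end

section
/- Let Λ be a Markov kernel from a finite set V̄ to a finite set V, let P̄ be a Markov kernel on V̄ reversible with respect to a positive probability μ̄, with μ := μ̄Λ positive on V, and assume ΛΛ*P̄Λ = P̄Λ. Define P := Λ*P̄Λ. Then P is a Markov kernel on V satisfying P̄Λ = ΛP, and for every K̄ ∈ K(P̄) the kernel Λ*K̄Λ belongs to K(P); i.e. Λ*K(P̄)Λ ⊆ K(P). -/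
open scoped BigOperators

theorem dualKernel_apply_nonneg {Vb V : Type*} {μb : Vb → ℝ} {μ : V → ℝ} {Λ : Matrix Vb V ℝ}
    (hμb : ∀ x, 0 ≤ μb x) (hμ : ∀ x, 0 ≤ μ x) (hΛ : ∀ x y, 0 ≤ Λ x y) (x : V) (xb : Vb) :
    0 ≤ dualKernel μb μ Λ x xb :=
  div_nonneg (mul_nonneg (hμb xb) (hΛ xb x)) (hμ x)

theorem dualKernel_row_sum {Vb V : Type*} [Fintype Vb] {μb : Vb → ℝ} {μ : V → ℝ}
    {Λ : Matrix Vb V ℝ} (hμdef : μ = Matrix.vecMul μb Λ) (hμ : ∀ x, 0 < μ x) (x : V) :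
    ∑ xb, dualKernel μb μ Λ x xb = 1 := by
  have h : ∑ xb, μb xb * Λ xb x = μ x := by rw [hμdef]; rfl
  simp only [dualKernel, Matrix.of_apply]
  rw [← Finset.sum_div, h, div_self (hμ x).ne']

theorem isMarkovRect_dualKernel {Vb V : Type*} [Fintype Vb] {μb : Vb → ℝ} {μ : V → ℝ}
    {Λ : Matrix Vb V ℝ} (hμb : ∀ x, 0 ≤ μb x) (hμdef : μ = Matrix.vecMul μb Λ)
    (hμ : ∀ x, 0 < μ x) (hΛ : ∀ x y, 0 ≤ Λ x y) : IsMarkovRect (dualKernel μb μ Λ) :=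
  ⟨dualKernel_apply_nonneg hμb (fun x => (hμ x).le) hΛ, dualKernel_row_sum hμdef hμ⟩

theorem IsMarkovRect.mul {A B C : Type*} [Fintype B] [Fintype C]
    {M : Matrix A B ℝ} {N : Matrix B C ℝ} (hM : IsMarkovRect M) (hN : IsMarkovRect N) :
    IsMarkovRect (M * N) := by
  refine ⟨fun x y => ?_, fun x => ?_⟩
  · rw [Matrix.mul_apply]
    exact Finset.sum_nonneg fun z _ => mul_nonneg (hM.1 x z) (hN.1 z y)
  · simp only [Matrix.mul_apply]
    rw [Finset.sum_comm]
    simp only [← Finset.mul_sum, hN.2, mul_one, hM.2]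

theorem diagonal_mul_dualKernel {Vb V : Type*} [Fintype Vb] [DecidableEq Vb] [Fintype V]
    [DecidableEq V] {μb : Vb → ℝ} {μ : V → ℝ} (Λ : Matrix Vb V ℝ) (hμ : ∀ x, μ x ≠ 0) :
    Matrix.diagonal μ * dualKernel μb μ Λ = Λ.transpose * Matrix.diagonal μb := by
  ext x xb
  simp only [Matrix.diagonal_mul, Matrix.mul_diagonal, dualKernel, Matrix.of_apply,
    Matrix.transpose_apply]
  field_simp [hμ x]

theorem IsReversible.diagonal_mul {V : Type*} [Fintype V] [DecidableEq V] {P : Matrix V V ℝ}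
    {μ : V → ℝ} (h : IsReversible P μ) :
    Matrix.diagonal μ * P = P.transpose * Matrix.diagonal μ := by
  ext x y
  simp only [Matrix.diagonal_mul, Matrix.mul_diagonal, Matrix.transpose_apply]
  rw [h x y, mul_comm]

/-- The intertwining `P̄Λ = ΛP` of reversible kernels dualizes to `Λ*P̄ = PΛ*`. -/
theorem dualKernel_mul_eq_mul_dualKernel {Vb V : Type*} [Fintype Vb] [DecidableEq Vb]
    [Fintype V] [DecidableEq V] {μb : Vb → ℝ} {μ : V → ℝ} {Λ : Matrix Vb V ℝ}
    {Pb : Matrix Vb Vb ℝ} {P : Matrix V V ℝ} (hμ : ∀ x, μ x ≠ 0) (hrev : IsReversible Pb μb)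
    (hint : Pb * Λ = Λ * P) (hP : P = dualKernel μb μ Λ * Pb * Λ) :
    dualKernel μb μ Λ * Pb = P * dualKernel μb μ Λ := by
  have hd := diagonal_mul_dualKernel (μb := μb) Λ hμ
  have hr := hrev.diagonal_mul
  have ht : Λ.transpose * Pb.transpose = P.transpose * Λ.transpose := by
    rw [← Matrix.transpose_mul, hint, Matrix.transpose_mul]
  have h₁ : Matrix.diagonal μ * dualKernel μb μ Λ * Pb =
      P.transpose * Λ.transpose * Matrix.diagonal μb := by
    rw [hd, Matrix.mul_assoc, hr, ← Matrix.mul_assoc, ht]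
  have h₂ : Matrix.diagonal μ * P = P.transpose * Matrix.diagonal μ := by
    have h : Matrix.diagonal μ * P = P.transpose * Λ.transpose * Matrix.diagonal μb * Λ := by
      conv_lhs => rw [hP]
      rw [← h₁]
      simp only [Matrix.mul_assoc]
    have hsymm : (Matrix.diagonal μ * P).transpose = Matrix.diagonal μ * P := by
      rw [h, ← ht, Matrix.mul_assoc Λ.transpose, ← hr]
      simp only [Matrix.transpose_mul, Matrix.transpose_transpose, Matrix.diagonal_transpose,
        Matrix.mul_assoc]
      rw [← Matrix.mul_assoc Pb.transpose, ← hr, Matrix.mul_assoc]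
    rw [← hsymm, Matrix.transpose_mul, Matrix.diagonal_transpose]
  have h₃ : Matrix.diagonal μ * (dualKernel μb μ Λ * Pb) =
      Matrix.diagonal μ * (P * dualKernel μb μ Λ) := by
    rw [← Matrix.mul_assoc, h₁, ← Matrix.mul_assoc, h₂, Matrix.mul_assoc, Matrix.mul_assoc, hd]
  ext x xb
  have h := congrFun (congrFun h₃ x) xb
  rw [Matrix.diagonal_mul, Matrix.diagonal_mul] at h
  exact mul_left_cancel₀ (hμ x) h

/-- If `P̄` is reversible with respect to the positive probability `μ̄`,
`μ := μ̄Λ` is positive and `ΛΛ*P̄Λ = P̄Λ`, then `P := Λ*P̄Λ` is a Markov kernel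
intertwined with `P̄` through `Λ` (`P̄Λ = ΛP`), and `Λ*K(P̄)Λ ⊆ K(P)`. -/
theorem dual_conjugation_maps_commutator
    {Vb V : Type*} [Fintype Vb] [DecidableEq Vb] [Fintype V] [DecidableEq V]
    (Λ : Matrix Vb V ℝ) (hΛ : IsMarkovRect Λ)
    (Pb : Matrix Vb Vb ℝ) (hPb : IsMarkov Pb)
    (μb : Vb → ℝ) (hμb : IsPositiveProb μb) (hrev : IsReversible Pb μb)
    (μ : V → ℝ) (hμdef : μ = Matrix.vecMul μb Λ) (hμpos : ∀ x, 0 < μ x)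
    (Λs : Matrix V Vb ℝ) (hΛs : Λs = dualKernel μb μ Λ)
    (hhyp : Λ * Λs * Pb * Λ = Pb * Λ)
    (P : Matrix V V ℝ) (hPdef : P = Λs * Pb * Λ) :
    IsMarkov P ∧ Pb * Λ = Λ * P ∧
    (∀ Kb ∈ MarkovCommutator Pb, Λs * Kb * Λ ∈ MarkovCommutator P) := by
  subst hΛs
  have hΛs := isMarkovRect_dualKernel (fun x => (hμb.1 x).le) hμdef hμpos hΛ.1
  have hint : Pb * Λ = Λ * P := by
    rw [hPdef, ← hhyp]
    simp only [Matrix.mul_assoc]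
  have hdual := dualKernel_mul_eq_mul_dualKernel (fun x => (hμpos x).ne') hrev hint hPdef
  refine ⟨?_, hint, ?_⟩
  · rw [hPdef]
    exact (hΛs.mul hPb).mul hΛ
  · rintro Kb ⟨hKb, hcomm⟩
    refine ⟨(hΛs.mul hKb).mul hΛ, ?_⟩
    rw [Matrix.mul_assoc, ← hint, ← Matrix.mul_assoc, Matrix.mul_assoc _ Kb, hcomm,
      ← Matrix.mul_assoc, hdual]
    simp only [Matrix.mul_assoc]
end

section
/- Let (P_n)_{n∈ℕ} be a sequence of Markov kernels on a finite set V converging (entrywise) to a Markov kernel P. Then: (i) if K_n ∈ K(P_n) for all n and K_n converges to a kernel K, then K ∈ K(P); (ii) for any x ∈ V, if m_n ∈ K(P_n,x) for all n and m_n converges to a probability m, then m ∈ K(P,x); (iii) for any x ∈ V, if x ∈ H(P_n) for infinitely many n, then x ∈ H(P). In particular, the set of Markov kernels P on V with H(P) ≠ ∅ is closed. -/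
open scoped BigOperators

/-- The set of Markov kernels on a finite set is compact. -/
theorem isCompact_setOf_isMarkov {V : Type*} [Fintype V] :
    IsCompact {P : Matrix V V ℝ | IsMarkov P} := by
  have hbox : IsCompact (Set.univ.pi fun _ : V => Set.univ.pi fun _ : V => Set.Icc (0 : ℝ) 1) :=
    isCompact_univ_pi fun _ => isCompact_univ_pi fun _ => isCompact_Icc
  refine IsCompact.of_isClosed_subset hbox ?_ ?_
  · have hentry (x y : V) : Continuous fun P : Matrix V V ℝ => P x y :=
      continuous_id.matrix_elem x y
    simp only [IsMarkov, Set.ofPred_and, Set.ofPred_forall]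
    exact (isClosed_iInter fun x => isClosed_iInter fun y =>
      isClosed_le continuous_const (hentry x y)).inter
      (isClosed_iInter fun x => isClosed_eq
        (continuous_finsetSum _ fun y _ => hentry x y) continuous_const)
  · intro P hP x _ y _
    refine ⟨hP.1 x y, ?_⟩
    rw [← hP.2 x]
    exact Finset.single_le_sum (f := P x) (fun z _ => hP.1 x z) (Finset.mem_univ y)

/-- The graph of the Markov commutator over the set of Markov kernels is compact. -/
theorem isCompact_graph_markovCommutator {V : Type*} [Fintype V] :
    IsCompact {p : Matrix V V ℝ × Matrix V V ℝ |
      IsMarkov p.1 ∧ p.2 ∈ MarkovCommutator p.1} := by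
  have hcomm : IsClosed {p : Matrix V V ℝ × Matrix V V ℝ | p.2 * p.1 = p.1 * p.2} :=
    isClosed_eq (continuous_snd.matrix_mul continuous_fst)
      (continuous_fst.matrix_mul continuous_snd)
  convert (isCompact_setOf_isMarkov.prod isCompact_setOf_isMarkov).inter_right hcomm using 1
  ext p
  simp [MarkovCommutator, and_assoc]

/-- The graph of `P ↦ K(P, x)` over the set of Markov kernels is closed. -/
theorem isClosed_graph_commRows {V : Type*} [Fintype V] (x : V) :
    IsClosed {p : Matrix V V ℝ × (V → ℝ) | IsMarkov p.1 ∧ p.2 ∈ commRows p.1 x} := by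
  have hrow : Continuous fun p : Matrix V V ℝ × Matrix V V ℝ => (p.1, fun y => p.2 x y) :=
    continuous_fst.prodMk (continuous_pi fun y => continuous_snd.matrix_elem x y)
  convert (isCompact_graph_markovCommutator.image hrow).isClosed using 1
  ext ⟨P, m⟩
  constructor
  · rintro ⟨hP, K, hK, rfl⟩
    exact ⟨(P, K), ⟨hP, hK⟩, rfl⟩
  · rintro ⟨⟨Q, K⟩, ⟨hQ, hK⟩, h⟩
    obtain ⟨rfl, rfl⟩ := Prod.mk.inj h
    exact ⟨hQ, K, hK, rfl⟩

/-- A point lies in `H(P)` iff every probability vector is a row at that point of an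
element of the Markov commutator. -/
theorem mem_HSet_iff {V : Type*} [Fintype V] {P : Matrix V V ℝ} {x : V} :
    x ∈ HSet P ↔ ∀ m, IsProbVec m → m ∈ commRows P x := by
  refine ⟨fun h m hm => h.symm.subset hm, fun h => Set.Subset.antisymm ?_ h⟩
  rintro _ ⟨K, hK, rfl⟩
  exact ⟨hK.1.1 x, hK.1.2 x⟩

/-- The set of Markov kernels `P` with `x ∈ H(P)` is closed. -/
theorem isClosed_setOf_mem_HSet {V : Type*} [Fintype V] (x : V) :
    IsClosed {P : Matrix V V ℝ | IsMarkov P ∧ x ∈ HSet P} := by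
  have hfiber (m : V → ℝ) : IsClosed {P : Matrix V V ℝ | IsMarkov P ∧ m ∈ commRows P x} :=
    (isClosed_graph_commRows x).preimage (continuous_id.prodMk continuous_const)
  convert isCompact_setOf_isMarkov.isClosed.inter
    (isClosed_biInter fun m (_ : m ∈ {m : V → ℝ | IsProbVec m}) => hfiber m) using 1
  ext P
  simp only [Set.mem_ofPred_eq, Set.mem_inter_iff, Set.mem_iInter, mem_HSet_iff]
  exact ⟨fun h => ⟨h.1, fun m hm => ⟨h.1, h.2 m hm⟩⟩, fun h => ⟨h.1, fun m hm => (h.2 m hm).2⟩⟩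

/-- Upper semi-continuity of the Markov commutator, of `K(·,x)` and of
`H(·)` along converging sequences of Markov kernels; in particular the set of Markov
kernels with nonempty `H` is closed. -/
theorem commutator_upper_semicontinuous
    {V : Type*} [Fintype V] [DecidableEq V] :
    (∀ (Pseq : ℕ → Matrix V V ℝ) (P : Matrix V V ℝ),
      (∀ n, IsMarkov (Pseq n)) → IsMarkov P →
      Filter.Tendsto Pseq Filter.atTop (nhds P) →
      ((∀ (Kseq : ℕ → Matrix V V ℝ) (K : Matrix V V ℝ),
          (∀ n, Kseq n ∈ MarkovCommutator (Pseq n)) →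
          Filter.Tendsto Kseq Filter.atTop (nhds K) →
          K ∈ MarkovCommutator P) ∧
       (∀ (x : V) (mseq : ℕ → V → ℝ) (m : V → ℝ),
          (∀ n, mseq n ∈ commRows (Pseq n) x) →
          Filter.Tendsto mseq Filter.atTop (nhds m) → IsProbVec m →
          m ∈ commRows P x) ∧
       (∀ x : V, (∀ N : ℕ, ∃ n ≥ N, x ∈ HSet (Pseq n)) → x ∈ HSet P))) ∧
    IsClosed {Q : Matrix V V ℝ | IsMarkov Q ∧ (HSet Q).Nonempty} := by
  refine ⟨fun Pseq P hPseq _ hlim => ⟨fun Kseq K hK hKlim => ?_, fun x mseq m hm hmlim _ => ?_,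
    fun x hx => ?_⟩, ?_⟩
  · exact (isCompact_graph_markovCommutator.isClosed.mem_of_tendsto (hlim.prodMk_nhds hKlim)
      (Filter.Eventually.of_forall fun n => ⟨hPseq n, hK n⟩)).2
  · exact ((isClosed_graph_commRows x).mem_of_tendsto (hlim.prodMk_nhds hmlim)
      (Filter.Eventually.of_forall fun n => ⟨hPseq n, hm n⟩)).2
  · exact ((isClosed_setOf_mem_HSet x).mem_of_frequently_of_tendsto
      ((Filter.frequently_atTop.2 hx).mono fun n hn => ⟨hPseq n, hn⟩) hlim).2
  · convert isClosed_iUnion_of_finite fun x : V => isClosed_setOf_mem_HSet x using 1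
    ext Q
    simp [Set.Nonempty]
end
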